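/- arXiv:2307.10109 — 2 statements merged into one kernel-verified Lean document; each statement's English description precedes it below -/
import Mathlib

section
/- Let n ∈ ℕ and for each 1 ≤ j ≤ n let (X_j, d_j, μ_j) be a metric space equipped with a σ-finite doubling Borel regular measure μ_j. Let X = ∏_{j=1}^n X_j with metric d = max_{1≤j≤n} d_j and product measure μ = ∏_{j=1}^n μ_j. Let (S_i)_{i∈ℕ} be a sequence of subsets of supp μ and (δ_i)_{i∈ℕ} a sequence of positive n-tuples δ_i = (δ_i^{(1)},…,δ_i^{(n)}) with δ_i^{(j)} → 0 as i → ∞ for each j. For a positive n-tuple ε = (ε^{(1)},…,ε^{(n)}) set Δ_n(S_i, ε) = {x ∈ X : ∃ a ∈ S_i with d_j(a_j, x_j) < ε^{(j)} for all 1 ≤ j ≤ n}. Then for any C = (C_1,…,C_n) and c = (c_1,…,c_n) with 0 < c_j ≤ C_j for each j, μ(limsup_{i→∞} Δ_n(S_i, Cδ_i) \ limsup_{i→∞} Δ_n(S_i, cδ_i)) = 0, where cδ_i = (c_1 δ_i^{(1)},…,c_n δ_i^{(n)}) and Cδ_i = (C_1 δ_i^{(1)},…,C_n δ_i^{(n)}).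 -/
open MeasureTheory Metric Filter
open scoped NNReal ENNReal

/-- The (topological) support of a measure on a metric space. -/
def measSupport {X : Type*} [MetricSpace X] [MeasurableSpace X] (μ : Measure X) : Set X :=
  {x | ∀ r : ℝ, 0 < r → 0 < μ (ball x r)}

/-- A measure `μ` on a metric space is *doubling* if there are `λ > 0` and `r₀ > 0` such
that `μ(B(x,2r)) ≤ λ · μ(B(x,r))` for every `x ∈ supp μ` and every `0 < r < r₀`. -/
def IsDoublingMeasure {X : Type*} [MetricSpace X] [MeasurableSpace X] (μ : Measure X) : Prop :=
  ∃ (lam : ℝ≥0) (r₀ : ℝ), 0 < lam ∧ 0 < r₀ ∧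
    ∀ x ∈ measSupport μ, ∀ r : ℝ, 0 < r → r < r₀ →
      μ (ball x (2 * r)) ≤ (lam : ℝ≥0∞) * μ (ball x r)

variable {n : ℕ} {X : Fin n → Type*} [∀ j, MetricSpace (X j)]

/-- `Δ_n(S, ε)`: the weighted `ε`-neighbourhood of a subset `S` of the product space. -/
def DeltaN (S : Set (∀ j, X j)) (ε : Fin n → ℝ) : Set (∀ j, X j) :=
  {x | ∃ a ∈ S, ∀ j, dist (a j) (x j) < ε j}

/-- Pairwise disjoint measurable sets which all have positive measure for an s-finite measure form
a countable family. -/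
lemma countable_of_pairwiseDisjoint_measure_pos {Y ι : Type*} [MeasurableSpace Y] {μ : Measure Y}
    [SFinite μ] {u : Set ι} {A : ι → Set Y} (hA : ∀ i ∈ u, MeasurableSet (A i))
    (hdisj : u.PairwiseDisjoint A) (hpos : ∀ i ∈ u, 0 < μ (A i)) : u.Countable := by
  have h := Measure.countable_meas_pos_of_disjoint_iUnion (μ := μ) (As := fun i : u => A i)
    (fun i => hA i i.2) (fun i j hij => hdisj i.2 j.2 (Subtype.coe_ne_coe.2 hij))
  have huniv : {i : u | 0 < μ (A i)} = Set.univ := Set.eq_univ_of_forall fun i => hpos i i.2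
  rw [huniv, Set.countable_univ_iff] at h
  exact Set.countable_coe_iff.1 h

lemma isSeparable_measSupport {Y : Type*} [MetricSpace Y] [MeasurableSpace Y] (μ : Measure Y)
    [SFinite μ] (hball : ∀ (x : Y) (r : ℝ), MeasurableSet (ball x r)) :
    TopologicalSpace.IsSeparable (measSupport μ) := by
  suffices h : ∃ t, t ⊆ measSupport μ ∧ t.Countable ∧ measSupport μ ⊆ closure t by
    obtain ⟨t, -, ht, hsub⟩ := h
    exact ⟨t, ht, hsub⟩
  refine EMetric.subset_countable_closure_of_almost_dense_set _ fun ε hε => ?_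
  obtain ⟨ρ, hρ, hρε⟩ := ENNReal.lt_iff_exists_nnreal_btwn.1 hε
  have hρ0 : (0 : ℝ) < ρ := by exact_mod_cast hρ
  obtain ⟨u, hu, hdisj, hcov⟩ := Vitali.exists_disjoint_subfamily_covering_enlargement_closedBall
    (measSupport μ) id (fun _ => (ρ : ℝ) / 5) (ρ / 5) (fun _ _ => le_rfl) 5 (by norm_num)
  refine ⟨u, countable_of_pairwiseDisjoint_measure_pos (μ := μ) (A := fun a => ball a (ρ / 5))
    (fun a _ => hball a _) (hdisj.mono_on fun a _ => ball_subset_closedBall)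
    (fun a ha => hu ha _ (by positivity)), fun x hx => ?_⟩
  obtain ⟨b, hb, hxb⟩ := hcov x hx
  have hmem := hxb (mem_closedBall_self (by positivity : (0 : ℝ) ≤ ρ / 5))
  refine Set.mem_biUnion hb ?_
  rw [Metric.mem_closedEBall, edist_dist]
  refine le_trans ?_ hρε.le
  rw [ENNReal.ofReal_le_iff_le_toReal ENNReal.coe_ne_top, ENNReal.coe_toReal]
  rw [mem_closedBall] at hmem
  simpa [mul_div_cancel₀] using hmem

/-- Iterating the doubling inequality. -/
lemma measure_ball_two_pow_mul_le {Y : Type*} [MetricSpace Y] [MeasurableSpace Y] {μ : Measure Y}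
    {lam : ℝ≥0} {r₀ : ℝ} {x : Y}
    (h : ∀ r : ℝ, 0 < r → r < r₀ → μ (ball x (2 * r)) ≤ (lam : ℝ≥0∞) * μ (ball x r))
    (m : ℕ) {r : ℝ} (hr : 0 < r) (hr₀ : 2 ^ m * r < r₀) :
    μ (ball x (2 ^ m * r)) ≤ (lam : ℝ≥0∞) ^ m * μ (ball x r) := by
  induction m with
  | zero => simp
  | succ m ih =>
    have hlt : 2 ^ m * r < 2 ^ (m + 1) * r := by
      have : 0 < 2 ^ m * r := by positivity
      rw [pow_succ]; linarith
    calc μ (ball x (2 ^ (m + 1) * r)) = μ (ball x (2 * (2 ^ m * r))) := by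
          congr 2; ring
      _ ≤ lam * μ (ball x (2 ^ m * r)) := h _ (by positivity) (hlt.trans hr₀)
      _ ≤ lam * ((lam : ℝ≥0∞) ^ m * μ (ball x r)) := by gcongr; exact ih (hlt.trans hr₀)
      _ = (lam : ℝ≥0∞) ^ (m + 1) * μ (ball x r) := by ring

/-- A set of finite measure each of whose points is, at arbitrarily small scales `r`, within `C * r`
of a support point `a` such that `ball a (c * r)` misses the set, is null. -/
lemma measure_eq_zero_of_porous {Y : Type*} [MetricSpace Y] [MeasurableSpace Y] [BorelSpace Y]
    {μ : Measure Y} [SigmaFinite μ] [μ.OuterRegular] (hdbl : IsDoublingMeasure μ) {c C : ℝ}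
    (hc : 0 < c) (hcC : c ≤ C) {Z : Set Y} (hZ : μ Z ≠ ∞)
    (hpor : ∀ x ∈ Z, ∀ η > 0, ∃ a ∈ measSupport μ, ∃ r, 0 < r ∧ r < η ∧ dist a x < C * r ∧
      Disjoint Z (ball a (c * r))) : μ Z = 0 := by
  obtain ⟨lam, r₀, hlam, hr₀, hdbl⟩ := hdbl
  have hC : 0 < C := hc.trans_le hcC
  obtain ⟨m, hm⟩ := pow_unbounded_of_one_lt (5 * C / c) (one_lt_two : (1 : ℝ) < 2)
  rw [div_lt_iff₀ hc] at hm
  suffices hsmall : ∀ ε : ℝ≥0, 0 < ε → μ Z ≤ (lam : ℝ≥0∞) ^ m * ε by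
    have hlm : (0 : ℝ≥0) < lam ^ m := by positivity
    refine le_antisymm (ENNReal.le_of_forall_pos_le_add fun ε hε _ => ?_) zero_le
    refine (hsmall (ε / lam ^ m) (by positivity)).trans ?_
    rw [zero_add, ← ENNReal.coe_pow, ← ENNReal.coe_mul, mul_div_cancel₀ _ hlm.ne']
  intro ε hε
  obtain ⟨V, hZV, hV, hμV⟩ := Z.exists_isOpen_lt_add hZ (ENNReal.coe_ne_zero.2 hε.ne')
  have hloc : ∀ x ∈ Z, ∃ a ∈ measSupport μ, ∃ r, 0 < r ∧ C * r ≤ 1 ∧ 2 ^ m * (c * r) < r₀ ∧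
      dist a x < C * r ∧ Disjoint Z (ball a (c * r)) ∧ ball a (c * r) ⊆ V := by
    intro x hx
    obtain ⟨ρ, hρ, hρV⟩ := Metric.isOpen_iff.1 hV x (hZV hx)
    obtain ⟨a, ha, r, hr, hrη, hax, hdis⟩ := hpor x hx
      (min (1 / C) (min (r₀ / (2 ^ m * c)) (ρ / (2 * C)))) (by positivity)
    simp only [lt_min_iff] at hrη
    obtain ⟨h1, h2, h3⟩ := hrη
    rw [lt_div_iff₀ (by positivity)] at h1 h2 h3
    refine ⟨a, ha, r, hr, by linarith, by linarith, hax, hdis, fun y hy => hρV ?_⟩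
    rw [mem_ball] at hy ⊢
    have := dist_triangle y a x
    have : c * r ≤ C * r := by gcongr
    linarith
  choose! a ha r hr hr1 hrr₀ hax hdis hsub using hloc
  obtain ⟨u, huZ, hudisj, hcov⟩ := Vitali.exists_disjoint_subfamily_covering_enlargement_closedBall
    Z a (fun x => C * r x) 1 hr1 5 (by norm_num)
  have hbdisj : u.PairwiseDisjoint fun x => ball (a x) (c * r x) :=
    hudisj.mono_on fun x hx => (ball_subset_ball
      (mul_le_mul_of_nonneg_right hcC (hr x (huZ hx)).le)).trans ball_subset_closedBall
  have hu : u.Countable := countable_of_pairwiseDisjoint_measure_pos (μ := μ)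
    (fun x _ => measurableSet_ball) hbdisj
    fun x hx => ha x (huZ hx) _ (mul_pos hc (hr x (huZ hx)))
  set M : Set Y := ⋃ x ∈ u, ball (a x) (c * r x) with hM
  have hMmeas : MeasurableSet M := .biUnion hu fun x _ => measurableSet_ball
  have hMε : μ M ≤ ε := by
    have hZM : Disjoint Z M := Set.disjoint_iUnion₂_right.2 fun x hx => hdis x (huZ hx)
    have hle : μ Z + μ M ≤ μ Z + ε := by
      rw [← measure_union hZM hMmeas]
      exact (measure_mono (Set.union_subset hZV
        (Set.iUnion₂_subset fun x hx => hsub x (huZ hx)))).trans hμV.le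
    exact (ENNReal.add_le_add_iff_left hZ).1 hle
  have hZcov : Z ⊆ ⋃ x ∈ u, ball (a x) (2 ^ m * (c * r x)) := by
    intro x hx
    obtain ⟨b, hb, hxb⟩ := hcov x hx
    have hmem := hxb (mem_closedBall'.2 (hax x hx).le)
    refine Set.mem_biUnion hb ?_
    rw [mem_closedBall] at hmem
    rw [mem_ball]
    have := mul_lt_mul_of_pos_right hm (hr b (huZ hb))
    linarith
  have := hu.to_subtype
  calc μ Z ≤ μ (⋃ x ∈ u, ball (a x) (2 ^ m * (c * r x))) := measure_mono hZcov
    _ ≤ ∑' x : u, μ (ball (a x) (2 ^ m * (c * r x))) := measure_biUnion_le μ hu _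
    _ ≤ ∑' x : u, (lam : ℝ≥0∞) ^ m * μ (ball (a x) (c * r x)) :=
        ENNReal.tsum_le_tsum fun x => measure_ball_two_pow_mul_le (hdbl _ (ha x (huZ x.2))) m
          (mul_pos hc (hr x (huZ x.2))) (hrr₀ x (huZ x.2))
    _ = (lam : ℝ≥0∞) ^ m * μ M := by
        rw [ENNReal.tsum_mul_left, hM, measure_biUnion hu hbdisj fun x _ => measurableSet_ball]
    _ ≤ (lam : ℝ≥0∞) ^ m * ε := by gcongr

/-- The one-factor case of `limsup_product_nbhds_diff_null`. -/
lemma limsup_nbhds_diff_null {Y : Type*} [MetricSpace Y] [MeasurableSpace Y] [BorelSpace Y]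
    {μ : Measure Y} [SigmaFinite μ] [μ.OuterRegular] (hdbl : IsDoublingMeasure μ)
    {T : ℕ → Set Y} (hT : ∀ i, T i ⊆ measSupport μ) {r : ℕ → ℝ} (hrpos : ∀ i, 0 < r i)
    (hr : Tendsto r atTop (nhds 0)) {c C : ℝ} (hc : 0 < c) (hcC : c ≤ C) :
    μ ((⋂ N : ℕ, ⋃ i : ℕ, ⋃ _ : N ≤ i, {x | ∃ a ∈ T i, dist a x < C * r i}) \
      ⋂ N : ℕ, ⋃ i : ℕ, ⋃ _ : N ≤ i, {x | ∃ a ∈ T i, dist a x < c * r i}) = 0 := by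
  rw [Set.sdiff_iInter, measure_iUnion_null_iff]
  intro N
  rw [← Set.inter_univ (_ \ _), ← iUnion_spanningSets μ, Set.inter_iUnion, measure_iUnion_null_iff]
  intro k
  refine measure_eq_zero_of_porous hdbl hc hcC
    ((measure_mono Set.inter_subset_right).trans_lt (measure_spanningSets_lt_top μ k)).ne ?_
  rintro x ⟨⟨hx, -⟩, -⟩ η hη
  obtain ⟨N', hN'⟩ := eventually_atTop.1 (hr.eventually_lt_const hη)
  simp only [Set.mem_iInter, Set.mem_iUnion] at hx
  obtain ⟨i, hi, a, ha, hax⟩ := hx (max N N')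
  refine ⟨a, hT i ha, r i, hrpos i, hN' i (le_of_max_le_right hi), hax,
    Set.disjoint_left.2 ?_⟩
  rintro y ⟨⟨-, hy⟩, -⟩ hya
  exact hy (Set.mem_iUnion₂.2 ⟨i, le_of_max_le_left hi, a, ha, mem_ball'.1 hya⟩)

section Pi

variable {ι : Type*} [Fintype ι] {Y : ι → Type*} [∀ j, MeasurableSpace (Y j)]

/-- A measurable set in a product whose slices in one fixed direction are null is null. -/
lemma measure_pi_eq_zero_of_slices [DecidableEq ι] (μ : ∀ j, Measure (Y j))
    [∀ j, SigmaFinite (μ j)] {E : Set (∀ j, Y j)} (hE : MeasurableSet E) (j : ι)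
    (h : ∀ x, μ j {t | Function.update x j t ∈ E} = 0) : Measure.pi μ E = 0 := by
  rcases E.eq_empty_or_nonempty with rfl | ⟨x₀, -⟩
  · simp
  have hzero : (fun x : ∀ j, Y j =>
      ∫⁻ t, E.indicator (fun _ => (1 : ℝ≥0∞)) (Function.update x j t) ∂μ j) = fun _ => 0 := by
    ext x
    exact (lintegral_indicator_one (measurable_update x hE)).trans (h x)
  rw [← lintegral_indicator_one hE, lintegral_eq_lmarginal_univ x₀]
  rw [lmarginal_erase' _ (measurable_one.indicator hE) (Finset.mem_univ j)]
  change lmarginal μ _ (fun x : ∀ j, Y j =>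
      ∫⁻ t, E.indicator (fun _ => (1 : ℝ≥0∞)) (Function.update x j t) ∂μ j) x₀ = 0
  rw [hzero]
  simp [lmarginal]

variable [∀ j, MetricSpace (Y j)]

lemma measurableSet_ball_pi [∀ j, OpensMeasurableSpace (Y j)] (x : ∀ j, Y j) (r : ℝ) :
    MeasurableSet (ball x r) := by
  rcases le_or_gt r 0 with hr | hr
  · simp [ball_eq_empty.2 hr]
  · rw [ball_pi x hr]
    exact .univ_pi fun j => measurableSet_ball

lemma apply_mem_measSupport {μ : ∀ j, Measure (Y j)} [∀ j, SigmaFinite (μ j)] {a : ∀ j, Y j}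
    (ha : a ∈ measSupport (Measure.pi μ)) (j : ι) : a j ∈ measSupport (μ j) := by
  intro r hr
  have h := ha r hr
  rw [ball_pi a hr, Measure.pi_pi] at h
  exact pos_iff_ne_zero.2 (Finset.prod_ne_zero_iff.1 h.ne' j (Finset.mem_univ j))

end Pi

section Neighbourhoods

lemma DeltaN_eq_biUnion (S : Set (∀ j, X j)) (ε : Fin n → ℝ) :
    DeltaN S ε = ⋃ a ∈ S, Set.univ.pi fun j => ball (a j) (ε j) := by
  ext x
  simp [DeltaN, dist_comm]

/-- On a separable set, a weighted neighbourhood is already a neighbourhood of a countable set. -/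
lemma exists_countable_inter_DeltaN_subset {K : Set (∀ j, X j)}
    (hK : TopologicalSpace.IsSeparable K) (S : Set (∀ j, X j)) (ε : Fin n → ℝ) :
    ∃ T ⊆ S, T.Countable ∧ K ∩ DeltaN S ε ⊆ DeltaN T ε := by
  have := hK.secondCountableTopology
  obtain ⟨T, hTS, hT, hEq⟩ := TopologicalSpace.isOpen_biUnion_countable S
    (fun a => ((↑) : K → ∀ j, X j) ⁻¹' Set.univ.pi fun j => ball (a j) (ε j))
    fun a _ => (isOpen_set_pi Set.finite_univ fun j _ => isOpen_ball).preimage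
      continuous_subtype_val
  refine ⟨T, hTS, hT, ?_⟩
  rintro x ⟨hxK, hx⟩
  rw [DeltaN_eq_biUnion] at hx ⊢
  simp only [← Set.preimage_iUnion₂] at hEq
  exact (Set.ext_iff.1 hEq ⟨x, hxK⟩).2 hx

/-- The limsup set of shrinking neighbourhoods of subsets of the support lies in the support. -/
lemma limsup_DeltaN_subset_measSupport [∀ j, MeasurableSpace (X j)]
    {μ : Measure (∀ j, X j)}
    {S : ℕ → Set (∀ j, X j)} (hS : ∀ i, S i ⊆ measSupport μ) {ε : ℕ → Fin n → ℝ}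
    (hε : ∀ j, Tendsto (fun i => ε i j) atTop (nhds 0)) :
    (⋂ N : ℕ, ⋃ i : ℕ, ⋃ _ : N ≤ i, DeltaN (S i) (ε i)) ⊆ measSupport μ := by
  intro x hx r hr
  obtain ⟨N, hN⟩ := eventually_atTop.1
    (eventually_all.2 fun j => (hε j).eventually_lt_const (half_pos hr))
  simp only [Set.mem_iInter, Set.mem_iUnion] at hx
  obtain ⟨i, hi, a, ha, hax⟩ := hx N
  have hdist : dist a x < r / 2 :=
    (dist_pi_lt_iff (half_pos hr)).2 fun j => (hax j).trans (hN i hi j)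
  exact (hS i ha _ (half_pos hr)).trans_le (measure_mono (ball_subset_ball' (by linarith)))

variable [∀ j, MeasurableSpace (X j)] [∀ j, BorelSpace (X j)]

lemma measurableSet_DeltaN {S : Set (∀ j, X j)} (hS : S.Countable) (ε : Fin n → ℝ) :
    MeasurableSet (DeltaN S ε) := by
  rw [DeltaN_eq_biUnion]
  exact .biUnion hS fun a _ => .univ_pi fun j => measurableSet_ball

lemma measurableSet_limsup_DeltaN {S : ℕ → Set (∀ j, X j)} (hS : ∀ i, (S i).Countable)
    (ε : ℕ → Fin n → ℝ) :
    MeasurableSet (⋂ N : ℕ, ⋃ i : ℕ, ⋃ _ : N ≤ i, DeltaN (S i) (ε i)) :=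
  .iInter fun _ => .iUnion fun i => .iUnion fun _ => measurableSet_DeltaN (hS i) (ε i)

/-- Shrinking the neighbourhoods in a single direction changes the limsup set by a null set. -/
lemma limsup_DeltaN_diff_update_null (μ : ∀ j, Measure (X j)) [∀ j, SigmaFinite (μ j)]
    [∀ j, (μ j).OuterRegular] (hdbl : ∀ j, IsDoublingMeasure (μ j))
    {S : ℕ → Set (∀ j, X j)} (hS : ∀ i, S i ⊆ measSupport (Measure.pi μ))
    (hScount : ∀ i, (S i).Countable) {δ : ℕ → Fin n → ℝ} (hδpos : ∀ i j, 0 < δ i j)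
    (hδ : ∀ j, Tendsto (fun i => δ i j) atTop (nhds 0)) (w : Fin n → ℝ) {j : Fin n} {b : ℝ}
    (hb : 0 < b) (hbw : b ≤ w j) :
    Measure.pi μ
      ((⋂ N : ℕ, ⋃ i : ℕ, ⋃ _ : N ≤ i, DeltaN (S i) fun k => w k * δ i k) \
        ⋂ N : ℕ, ⋃ i : ℕ, ⋃ _ : N ≤ i,
          DeltaN (S i) fun k => Function.update w j b k * δ i k) = 0 := by
  refine measure_pi_eq_zero_of_slices μ
    ((measurableSet_limsup_DeltaN hScount _).diff (measurableSet_limsup_DeltaN hScount _)) j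
    fun x => ?_
  let T : ℕ → Set (X j) := fun i =>
    (fun a => a j) '' {a ∈ S i | ∀ k, k ≠ j → dist (a k) (x k) < w k * δ i k}
  have hT : ∀ i, T i ⊆ measSupport (μ j) := by
    rintro i _ ⟨a, ⟨ha, -⟩, rfl⟩
    exact apply_mem_measSupport (hS i ha) j
  have hslice : ∀ (v : Fin n → ℝ), (∀ k, k ≠ j → v k = w k) → ∀ i t,
      Function.update x j t ∈ DeltaN (S i) (fun k => v k * δ i k) ↔
        t ∈ {t | ∃ s ∈ T i, dist s t < v j * δ i j} := by
    intro v hv i t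
    constructor
    · rintro ⟨a, ha, h⟩
      refine ⟨a j, ⟨a, ⟨ha, fun k hk => ?_⟩, rfl⟩, by simpa using h j⟩
      simpa [hk, hv k hk] using h k
    · rintro ⟨_, ⟨a, ⟨ha, h⟩, rfl⟩, hj⟩
      refine ⟨a, ha, fun k => ?_⟩
      by_cases hk : k = j
      · subst hk; simpa using hj
      · simpa [hk, hv k hk] using h k hk
  convert limsup_nbhds_diff_null (hdbl j) hT (fun i => hδpos i j) (hδ j) hb hbw using 2
  ext t
  have h₁ := fun i => hslice w (fun _ _ => rfl) i t
  have h₂ := fun i => hslice (Function.update w j b)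
    (fun k hk => Function.update_of_ne hk _ _) i t
  simp only [Set.mem_ofPred_eq, Function.update_self] at h₁ h₂
  simp only [Set.mem_ofPred_eq, Set.mem_sdiff, Set.mem_iInter, Set.mem_iUnion, h₁, h₂]

/-- The case of countable sets `S i` of `limsup_product_nbhds_diff_null`. -/
lemma limsup_DeltaN_diff_null_of_countable (μ : ∀ j, Measure (X j)) [∀ j, SigmaFinite (μ j)]
    [∀ j, (μ j).OuterRegular] (hdbl : ∀ j, IsDoublingMeasure (μ j))
    {S : ℕ → Set (∀ j, X j)} (hS : ∀ i, S i ⊆ measSupport (Measure.pi μ))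
    (hScount : ∀ i, (S i).Countable) {δ : ℕ → Fin n → ℝ} (hδpos : ∀ i j, 0 < δ i j)
    (hδ : ∀ j, Tendsto (fun i => δ i j) atTop (nhds 0))
    {c C : Fin n → ℝ} (hc : ∀ j, 0 < c j) (hcC : ∀ j, c j ≤ C j) :
    Measure.pi μ
      ((⋂ N : ℕ, ⋃ i : ℕ, ⋃ _ : N ≤ i, DeltaN (S i) fun j => C j * δ i j) \
        ⋂ N : ℕ, ⋃ i : ℕ, ⋃ _ : N ≤ i, DeltaN (S i) fun j => c j * δ i j) = 0 := by
  suffices h : ∀ s : Finset (Fin n), Measure.pi μ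
      ((⋂ N : ℕ, ⋃ i : ℕ, ⋃ _ : N ≤ i, DeltaN (S i) fun j => C j * δ i j) \
        ⋂ N : ℕ, ⋃ i : ℕ, ⋃ _ : N ≤ i, DeltaN (S i) fun j => s.piecewise c C j * δ i j) = 0 by
    simpa using h Finset.univ
  intro s
  induction s using Finset.induction_on with
  | empty => simp
  | insert j s hj ih =>
    have hstep := limsup_DeltaN_diff_update_null μ hdbl hS hScount hδpos hδ (s.piecewise c C)
      (j := j) (hc j) (by simpa [hj] using hcC j)
    rw [Finset.piecewise_insert]
    exact measure_mono_null (sdiff_triangle _ _ _) (measure_union_null ih hstep)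

end Neighbourhoods

/-- Lemma (CI, product case): for σ-finite doubling Borel regular measures `μ_j` on
metric spaces `X_j`, subsets `S_i` of the support of the product measure, and positive
`n`-tuples `δ_i → 0`, the difference of the limsup sets of the `C·δ_i`- and
`c·δ_i`-neighbourhoods of the `S_i` is null, for any componentwise `0 < c_j ≤ C_j`. -/
theorem limsup_product_nbhds_diff_null
    [∀ j, MeasurableSpace (X j)] [∀ j, BorelSpace (X j)]
    (hn : 0 < n)
    (μ : ∀ j, Measure (X j)) [∀ j, SigmaFinite (μ j)] [∀ j, (μ j).OuterRegular]
    (hdbl : ∀ j, IsDoublingMeasure (μ j))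
    (S : ℕ → Set (∀ j, X j)) (hS : ∀ i, S i ⊆ measSupport (Measure.pi μ))
    (δ : ℕ → Fin n → ℝ) (hδpos : ∀ i j, 0 < δ i j)
    (hδ : ∀ j, Tendsto (fun i => δ i j) atTop (nhds 0))
    (c C : Fin n → ℝ) (hc : ∀ j, 0 < c j) (hcC : ∀ j, c j ≤ C j) :
    Measure.pi μ
      ((⋂ N : ℕ, ⋃ i : ℕ, ⋃ _ : N ≤ i, DeltaN (S i) fun j => C j * δ i j) \
        ⋂ N : ℕ, ⋃ i : ℕ, ⋃ _ : N ≤ i, DeltaN (S i) fun j => c j * δ i j) = 0 := by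
  choose T hT using fun i =>
    exists_countable_inter_DeltaN_subset
      (isSeparable_measSupport (Measure.pi μ) measurableSet_ball_pi) (S i) fun j => C j * δ i j
  refine measure_mono_null ?_ (limsup_DeltaN_diff_null_of_countable μ hdbl
    (fun i => (hT i).1.trans (hS i)) (fun i => (hT i).2.1) hδpos hδ hc hcC)
  rintro x ⟨hxC, hxc⟩
  have hx : x ∈ measSupport (Measure.pi μ) := limsup_DeltaN_subset_measSupport hS
    (fun j => by simpa using (hδ j).const_mul (C j)) hxC
  simp only [Set.mem_iInter, Set.mem_iUnion] at hxC hxc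
  refine ⟨?_, fun h => hxc ?_⟩
  · simp only [Set.mem_iInter, Set.mem_iUnion]
    intro N
    obtain ⟨i, hi, hxi⟩ := hxC N
    exact ⟨i, hi, (hT i).2.2 ⟨hx, hxi⟩⟩
  · simp only [Set.mem_iInter, Set.mem_iUnion] at h
    intro N
    obtain ⟨i, hi, a, ha, hax⟩ := h N
    exact ⟨i, hi, a, (hT i).1 ha, hax⟩
end

section
/- Let n, m ∈ ℕ, S a finite nonempty set of places of ℚ, ω = m+n if ∞ ∉ S and ω = m if ∞ ∈ S. Let τ = (τ_{i,ν})_{1≤i≤n, ν∈S} and η = (η_ℓ)_{1≤ℓ≤ω} be collections of positive reals with Σ_{i=1}^n Σ_{ν∈S} τ_{i,ν} = ω = Σ_{ℓ=1}^ω η_ℓ. Then for any x = (x_{i,j,ν}) ∈ ℤ_S^{mn} and any H > 1 there exists a nonzero (a,b) = (a_1,…,a_m,b_1,…,b_n) ∈ ℤ^{m+n} satisfying: |a_1 x_{i,1,ν} + ⋯ + a_m x_{i,m,ν} − b_i|_ν ≤ ν·H^{-τ_{i,ν}} for all 1 ≤ i ≤ n and all finite ν ∈ S*; |a_1 x_{i,1,∞}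 + ⋯ + a_m x_{i,m,∞} − b_i| < H^{-τ_{i,∞}} for all 1 ≤ i ≤ n if ∞ ∈ S; |a_j| ≤ H^{η_j} for 1 ≤ j ≤ m; and |b_i| ≤ H^{η_{m+i}} for 1 ≤ i ≤ n if ∞ ∉ S. Furthermore, if ∞ ∈ S, or if η_{m+i} < Σ_{ν∈S} τ_{i,ν} for all 1 ≤ i ≤ n, then for all sufficiently large H every nonzero (a,b) ∈ ℤ^{m+n} satisfying the above system has a ≠ 0. -/
open MeasureTheory

noncomputable section

/-- Choice of the Borel σ-algebra on the `p`-adic integers. -/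
instance padicIntMeasurableSpace (p : ℕ) [Fact p.Prime] : MeasurableSpace ℤ_[p] := borel _

instance padicIntBorelSpace (p : ℕ) [Fact p.Prime] : BorelSpace ℤ_[p] := ⟨rfl⟩

/-- The Haar probability measure on the compact additive group `ℤ_p`,
normalised so that `ℤ_p` itself has measure one. -/
def padicHaar (p : ℕ) [Fact p.Prime] : Measure ℤ_[p] :=
  Measure.addHaarMeasure (⊤ : TopologicalSpace.PositiveCompacts ℤ_[p])

instance padicHaarSigmaFinite (p : ℕ) [Fact p.Prime] : SigmaFinite (padicHaar p) := by
  unfold padicHaar; infer_instance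

/-- A place of `ℚ`: `none` is the infinite place, `some p` is the prime `p`. -/
abbrev Pl : Type := Option Nat.Primes

namespace Pl

/-- The "integer ring" attached to a place: `ℝ` for the infinite place (with the
measure supported on `[0,1)`) and `ℤ_p` for a finite place `p`. -/
def carrier : Pl → Type
  | none => ℝ
  | some p => @PadicInt p.1 ⟨p.2⟩

instance : (v : Pl) → CommRing (carrier v)
  | none => inferInstanceAs (CommRing ℝ)
  | some p => inferInstanceAs (CommRing (@PadicInt p.1 ⟨p.2⟩))

instance : (v : Pl) → MeasurableSpace (carrier v)
  | none => inferInstanceAs (MeasurableSpace ℝ)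
  | some p => letI : Fact p.1.Prime := ⟨p.2⟩; inferInstanceAs (MeasurableSpace ℤ_[p.1])

/-- The normalised Haar measure at a place: Lebesgue measure restricted to `[0,1)`
at the infinite place, and the normalised Haar measure of `ℤ_p` at a finite place. -/
def mu : (v : Pl) → Measure (carrier v)
  | none => volume.restrict (Set.Ico (0 : ℝ) 1)
  | some p => letI : Fact p.1.Prime := ⟨p.2⟩; padicHaar p.1

instance : ∀ v : Pl, SigmaFinite (mu v)
  | none => inferInstanceAs (SigmaFinite (volume.restrict (Set.Ico (0 : ℝ) 1)))
  | some p => letI : Fact p.1.Prime := ⟨p.2⟩;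
      inferInstanceAs (SigmaFinite (padicHaar p.1))

/-- The absolute value `|·|_ν` at a place. -/
def absv : (v : Pl) → carrier v → ℝ
  | none, x => |x|
  | some p, x => letI : Fact p.1.Prime := ⟨p.2⟩;
      ‖(show ℤ_[p.1] from x)‖

/-- Membership in `ℤ_ν`; at the infinite place `ℤ_∞ = [0,1)`. -/
def inZ : (v : Pl) → carrier v → Prop
  | none, x => x ∈ Set.Ico (0 : ℝ) 1
  | some _, _ => True

end Pl

/-- `ℤ_S^{mn}`, the space of `S`-arithmetic `n × m` matrices. -/
def SpaceS (S : Finset Pl) (m n : ℕ) : Type :=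
  (v : S) → Fin n → Fin m → Pl.carrier v

instance (S : Finset Pl) (m n : ℕ) : MeasurableSpace (SpaceS S m n) :=
  inferInstanceAs (MeasurableSpace ((v : S) → Fin n → Fin m → Pl.carrier v))

/-- The normalised product Haar measure `μ_{S,m×n}` on `ℤ_S^{mn}`. -/
def muS (S : Finset Pl) (m n : ℕ) : Measure (SpaceS S m n) :=
  Measure.pi fun v : S => Measure.pi fun _ : Fin n => Measure.pi fun _ : Fin m => Pl.mu v

/-- The value `a₁ x_{i,1,ν} + ⋯ + a_m x_{i,m,ν} - b_i` at the place `ν`. -/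
def linForm {m n : ℕ} (v : Pl) (x : Fin n → Fin m → Pl.carrier v)
    (a : Fin m → ℤ) (b : Fin n → ℤ) (i : Fin n) : Pl.carrier v :=
  (∑ j, (a j : Pl.carrier v) * x i j) - (b i : Pl.carrier v)

/-- `‖a‖_ν = max_j |a_j|_ν` for an integer vector `a`. -/
def aNorm {m : ℕ} (v : Pl) (a : Fin m → ℤ) : ℝ :=
  if h : (Finset.univ : Finset (Fin m)).Nonempty then
    Finset.univ.sup' h fun j => Pl.absv v ((a j : ℤ) : Pl.carrier v)
  else 0

/-- The sup-norm `‖(a,b)‖_∞` of an integer vector. -/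
def height {m n : ℕ} (a : Fin m → ℤ) (b : Fin n → ℤ) : ℕ :=
  (Finset.univ.sup fun j => (a j).natAbs) ⊔ (Finset.univ.sup fun i => (b i).natAbs)


/-- The underlying rational prime of a finite place (and `0` at the infinite place). -/
def Pl.nval : Pl → ℕ
  | none => 0
  | some p => p.1

/-- The weighted Dirichlet system \eqref{vb042}–\eqref{integer_condition4}:
`|a·x_{i,ν} − b_i|_ν ≤ ν H^{−τ_{i,ν}}` at finite places, `< H^{−τ_{i,∞}}` at the
infinite place, `|a_j| ≤ H^{η_j}`, and `|b_i| ≤ H^{η_{m+i}}` when `∞ ∉ S`. -/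
def DiriSys (S : Finset Pl) {m n : ℕ} (τ : Pl → Fin n → ℝ)
    (ηa : Fin m → ℝ) (ηb : Fin n → ℝ) (H : ℝ) (x : SpaceS S m n)
    (a : Fin m → ℤ) (b : Fin n → ℤ) : Prop :=
  (∀ (v : S) (i : Fin n), (v : Pl) ≠ none →
    Pl.absv v (linForm v (x v) a b i) ≤ (Pl.nval v : ℝ) * H ^ (-(τ v i))) ∧
  (∀ (v : S) (i : Fin n), (v : Pl) = none →
    Pl.absv v (linForm v (x v) a b i) < H ^ (-(τ v i))) ∧
  (∀ j, |(a j : ℝ)| ≤ H ^ ηa j) ∧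
  (none ∉ S → ∀ i, |(b i : ℝ)| ≤ H ^ ηb i)

/-- **Minkowski's linear forms theorem**, with all inequalities strict. -/
theorem Matrix.exists_int_ne_zero_abs_mulVec_lt {ι : Type*} [Fintype ι] [DecidableEq ι]
    (M : Matrix ι ι ℝ) (hM : M.det ≠ 0) (c : ι → ℝ) (hc : ∀ i, 0 < c i)
    (h : |M.det| < ∏ i, c i) :
    ∃ z : ι → ℤ, z ≠ 0 ∧ ∀ i, |M.mulVec (fun k => (z k : ℝ)) i| < c i := by
  have hdet : LinearMap.det (Matrix.toLin' M) ≠ 0 := by rwa [LinearMap.det_toLin']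
  have hconv : Convex ℝ (Matrix.toLin' M ⁻¹' Set.pi Set.univ fun i => Set.Ioo (-c i) (c i)) :=
    (convex_pi fun i _ => convex_Ioo _ _).linear_preimage _
  have hvol : volume (ZSpan.fundamentalDomain (Pi.basisFun ℝ ι)) *
      2 ^ Module.finrank ℝ (ι → ℝ) <
      volume (Matrix.toLin' M ⁻¹' Set.pi Set.univ fun i => Set.Ioo (-c i) (c i)) := by
    have hpos : 0 < |M.det| := abs_pos.mpr hM
    rw [Measure.addHaar_preimage_linearMap _ hdet, LinearMap.det_toLin', volume_pi_pi,
      ZSpan.fundamentalDomain_pi_basisFun, volume_pi_pi]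
    simp only [Real.volume_Ico, Real.volume_Ioo, sub_zero, ENNReal.ofReal_one,
      Finset.prod_const_one, one_mul, Module.finrank_fintype_fun_eq_card, sub_neg_eq_add,
      ← two_mul]
    rw [← ENNReal.ofReal_prod_of_nonneg fun i _ => by linarith [hc i],
      ← ENNReal.ofReal_mul (abs_nonneg _), ← ENNReal.ofReal_ofNat 2,
      ← ENNReal.ofReal_pow zero_le_two, ENNReal.ofReal_lt_ofReal_iff_of_nonneg (by positivity),
      Finset.prod_mul_distrib, Finset.prod_const, Finset.card_univ, abs_inv, mul_left_comm]
    refine lt_mul_of_one_lt_right (by positivity) ?_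
    rwa [← div_eq_inv_mul, one_lt_div hpos]
  have hsymm : ∀ x ∈ Matrix.toLin' M ⁻¹' Set.pi Set.univ fun i => Set.Ioo (-c i) (c i),
      -x ∈ Matrix.toLin' M ⁻¹' Set.pi Set.univ fun i => Set.Ioo (-c i) (c i) := fun x hx i _ => by
    have := hx i trivial
    simp only [map_neg, Pi.neg_apply, Set.mem_Ioo] at this ⊢
    constructor <;> linarith [this.1, this.2]
  have : Countable (Submodule.span ℤ (Set.range (Pi.basisFun ℝ ι))).toAddSubgroup :=
    inferInstanceAs (Countable (Submodule.span ℤ (Set.range (Pi.basisFun ℝ ι))))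
  obtain ⟨⟨y, hyL⟩, hy0, hy⟩ := exists_ne_zero_mem_lattice_of_measure_mul_two_pow_lt_measure
    (ZSpan.isAddFundamentalDomain' (Pi.basisFun ℝ ι) volume)
    hsymm hconv hvol
  have hz := ((Pi.basisFun ℝ ι).mem_span_iff_repr_mem ℤ y).mp hyL
  choose z hz using hz
  have hzy : (fun k => (z k : ℝ)) = y := funext fun k => by simpa using hz k
  refine ⟨z, ?_, fun i => ?_⟩
  · rintro rfl
    exact hy0 (Subtype.ext (by simpa [eq_comm, Pi.zero_def] using hzy))
  · rw [hzy, abs_lt]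
    exact hy i trivial

/-- The integer vectors whose image under an invertible real matrix lies in a given box form a
finite set. -/
theorem Matrix.finite_int_abs_mulVec_le {ι : Type*} [Fintype ι] [DecidableEq ι]
    (M : Matrix ι ι ℝ) (hM : M.det ≠ 0) (c : ι → ℝ) :
    {z : ι → ℤ | ∀ i, |M.mulVec (fun k => (z k : ℝ)) i| ≤ c i}.Finite := by
  refine (Set.finite_Icc (fun k => -⌈∑ l, |M⁻¹ k l| * c l⌉) fun k =>
    ⌈∑ l, |M⁻¹ k l| * c l⌉).subset fun z hz => ?_
  have hbound : ∀ k, |(z k : ℝ)| ≤ ∑ l, |M⁻¹ k l| * c l := fun k => by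
    have hinv : M⁻¹.mulVec (M.mulVec fun k => (z k : ℝ)) = fun k => (z k : ℝ) := by
      rw [Matrix.mulVec_mulVec, Matrix.nonsing_inv_mul M (isUnit_iff_ne_zero.mpr hM),
        Matrix.one_mulVec]
    calc |(z k : ℝ)| = |∑ l, M⁻¹ k l * M.mulVec (fun k => (z k : ℝ)) l| :=
          congrArg _ (congrFun hinv k).symm
      _ ≤ ∑ l, |M⁻¹ k l * M.mulVec (fun k => (z k : ℝ)) l| := Finset.abs_sum_le_sum_abs _ _
      _ ≤ ∑ l, |M⁻¹ k l| * c l := Finset.sum_le_sum fun l _ => by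
          rw [abs_mul]
          exact mul_le_mul_of_nonneg_left (hz l) (abs_nonneg _)
  have hint : ∀ k, |z k| ≤ ⌈∑ l, |M⁻¹ k l| * c l⌉ := fun k => by
    have := (hbound k).trans (Int.le_ceil _)
    exact_mod_cast this
  exact ⟨fun k => (abs_le.mp (hint k)).1, fun k => (abs_le.mp (hint k)).2⟩

/-- **Minkowski's linear forms theorem**: all but one of the inequalities may be taken strict. -/
theorem Matrix.exists_int_ne_zero_abs_mulVec_le {ι : Type*} [Fintype ι] [DecidableEq ι]
    (M : Matrix ι ι ℝ) (hM : M.det ≠ 0) (c : ι → ℝ) (hc : ∀ i, 0 < c i)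
    (h : |M.det| ≤ ∏ i, c i) (i₀ : ι) :
    ∃ z : ι → ℤ, z ≠ 0 ∧ |M.mulVec (fun k => (z k : ℝ)) i₀| ≤ c i₀ ∧
      ∀ i ≠ i₀, |M.mulVec (fun k => (z k : ℝ)) i| < c i := by
  have henlarge : ∀ t, c i₀ < t → ∃ z : ι → ℤ, z ≠ 0 ∧
      |M.mulVec (fun k => (z k : ℝ)) i₀| < t ∧
      ∀ i ≠ i₀, |M.mulVec (fun k => (z k : ℝ)) i| < c i := fun t ht => by
    obtain ⟨z, hz0, hz⟩ := M.exists_int_ne_zero_abs_mulVec_lt hM (Function.update c i₀ t)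
      (fun i => by
        rcases eq_or_ne i i₀ with rfl | hi
        · simpa using (hc i).trans ht
        · simpa [hi] using hc i)
      (h.trans_lt (by
        refine Finset.prod_lt_prod (fun i _ => hc i) (fun i _ => ?_)
          ⟨i₀, Finset.mem_univ _, by simpa using ht⟩
        rcases eq_or_ne i i₀ with rfl | hi
        · simpa using ht.le
        · simp [hi]))
    exact ⟨z, hz0, by simpa using hz i₀, fun i hi => by simpa [hi] using hz i⟩
  by_contra! hcon
  have hfin : {z : ι → ℤ | z ≠ 0 ∧ |M.mulVec (fun k => (z k : ℝ)) i₀| < c i₀ + 1 ∧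
      ∀ i ≠ i₀, |M.mulVec (fun k => (z k : ℝ)) i| < c i}.Finite :=
    (M.finite_int_abs_mulVec_le hM (fun i => c i + 1)).subset fun z hz i => by
      rcases eq_or_ne i i₀ with rfl | hi
      · exact hz.2.1.le
      · linarith [hz.2.2 i hi]
  obtain ⟨w, hw, hwmin⟩ := Set.exists_min_image _
    (fun z : ι → ℤ => |M.mulVec (fun k => (z k : ℝ)) i₀|) hfin (henlarge _ (lt_add_one _))
  have hwlt : c i₀ < |M.mulVec (fun k => (w k : ℝ)) i₀| := by
    by_contra! hle
    obtain ⟨i, hi, hi'⟩ := hcon w hw.1 hle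
    exact absurd (hw.2.2 i hi) hi'.not_gt
  obtain ⟨z, hz0, hz, hzlt⟩ := henlarge _ hwlt
  exact absurd (hwmin z ⟨hz0, hz.trans hw.2.1, hzlt⟩) hz.not_ge

/-- Simultaneous approximation of `p`-adic integers by a rational integer. -/
theorem exists_int_forall_pow_dvd_sub (T : Finset Nat.Primes) (k : Nat.Primes → ℕ)
    (x : (p : Nat.Primes) → @PadicInt p.1 ⟨p.2⟩) :
    ∃ X : ℤ, ∀ p ∈ T, letI : Fact p.1.Prime := ⟨p.2⟩
      ((p.1 : ℤ_[p.1]) ^ k p) ∣ x p - (X : ℤ_[p.1]) := by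
  let crt := Nat.chineseRemainderOfFinset
    (fun p : Nat.Primes => letI : Fact p.1.Prime := ⟨p.2⟩; PadicInt.appr (x p) (k p))
    (fun p => p.1 ^ k p) T (fun p _ => pow_ne_zero _ p.2.ne_zero)
    (fun p _ q _ hpq => Nat.Coprime.pow _ _
      ((Nat.coprime_primes p.2 q.2).mpr fun h => hpq (Subtype.ext h)))
  refine ⟨crt.1, fun p hp => ?_⟩
  let _ : Fact p.1.Prime := ⟨p.2⟩
  have happr := Ideal.mem_span_singleton.mp (PadicInt.appr_spec (k p) (x p))
  have hcrt : ((p.1 : ℤ_[p.1]) ^ k p) ∣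
      (((PadicInt.appr (x p) (k p) : ℤ) - (crt.1 : ℤ) : ℤ) : ℤ_[p.1]) := by
    rw [PadicInt.pow_p_dvd_int_iff]
    exact_mod_cast (Nat.modEq_iff_dvd.mp (crt.2 p hp))
  convert! dvd_add happr hcrt using 1
  push_cast
  ring

/-- A nonzero integer has archimedean absolute value at least the inverse of the product of its
`p`-adic absolute values over any finite set of primes. -/
theorem one_le_abs_mul_prod_padicNorm (T : Finset Nat.Primes) (b : ℤ) (hb : b ≠ 0) :
    1 ≤ |(b : ℝ)| * ∏ p ∈ T, letI : Fact p.1.Prime := ⟨p.2⟩; ‖(b : ℤ_[p.1])‖ := by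
  have hnorm : ∀ p : Nat.Primes, (letI : Fact p.1.Prime := ⟨p.2⟩; ‖(b : ℤ_[p.1])‖) =
      ((p.1 ^ padicValInt p.1 b : ℕ) : ℝ)⁻¹ := fun p => by
    let _ : Fact p.1.Prime := ⟨p.2⟩
    rw [PadicInt.norm_intCast_eq_padic_norm, Padic.norm_eq_zpow_neg_valuation (by exact_mod_cast hb)]
    simp
  have hdvd : (∏ p ∈ T, p.1 ^ padicValInt p.1 b) ∣ b.natAbs :=
    Finset.prod_dvd_of_isRelPrime
      (fun p _ q _ hpq => Nat.coprime_iff_isRelPrime.mp (Nat.Coprime.pow _ _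
        ((Nat.coprime_primes p.2 q.2).mpr fun h => hpq (Subtype.ext h))))
      (fun p _ => pow_padicValNat_dvd)
  have hle : ((∏ p ∈ T, p.1 ^ padicValInt p.1 b : ℕ) : ℝ) ≤ |(b : ℝ)| := by
    have := Nat.le_of_dvd (Int.natAbs_pos.mpr hb) hdvd
    rw [← Int.cast_abs, Int.abs_eq_natAbs]
    exact_mod_cast this
  simp_rw [hnorm, Finset.prod_inv_distrib, ← Nat.cast_prod]
  rw [← div_eq_mul_inv, one_le_div]
  · exact hle
  · exact_mod_cast Finset.prod_pos fun (p : Nat.Primes) _ => pow_pos p.2.pos (padicValInt p.1 b)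

/-- For `H > 1` and `t > 0` some power `p ^ k < H ^ t` satisfies `H ^ t ≤ p ^ (k + 1)`. -/
theorem exists_pow_lt_rpow_le_pow_succ {p : ℕ} (hp : 1 < p) {H t : ℝ} (hH : 1 < H)
    (ht : 0 < t) : ∃ k : ℕ, (p : ℝ) ^ k < H ^ t ∧ H ^ t ≤ (p : ℝ) ^ (k + 1) := by
  have hex : ∃ k : ℕ, H ^ t ≤ (p : ℝ) ^ (k + 1) := by
    obtain ⟨k, hk⟩ := pow_unbounded_of_one_lt (H ^ t) (show (1 : ℝ) < p by exact_mod_cast hp)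
    exact ⟨k, hk.le.trans (pow_le_pow_right₀ (by exact_mod_cast hp.le) k.le_succ)⟩
  classical
  refine ⟨Nat.find hex, ?_, Nat.find_spec hex⟩
  rcases hk : Nat.find hex with _ | k
  · simpa using Real.one_lt_rpow hH ht
  · exact not_le.mp (Nat.find_min hex (hk ▸ k.lt_succ_self))

/-- Existence of a nonzero integer solution to a system of real and `p`-adic inequalities whose
real box is at least as large as the index of the lattice cut out by the congruences. -/
theorem exists_int_padic_real_approx {m n : ℕ} (hm : 0 < m) (T : Finset Nat.Primes)
    (x : (p : Nat.Primes) → Fin n → Fin m → @PadicInt p.1 ⟨p.2⟩) (θ : Fin n → Fin m → ℝ)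
    (k : Nat.Primes → Fin n → ℕ) (A : Fin m → ℝ) (hA : ∀ j, 0 < A j) (B : Fin n → ℝ)
    (hB : ∀ i, 0 < B i)
    (h : ∏ i, ∏ p ∈ T, (p.1 : ℝ) ^ k p i ≤ (∏ j, A j) * ∏ i, B i) :
    ∃ (a : Fin m → ℤ) (b : Fin n → ℤ), ¬(a = 0 ∧ b = 0) ∧
      (∀ p ∈ T, ∀ i, letI : Fact p.1.Prime := ⟨p.2⟩
        ‖(∑ j, (a j : ℤ_[p.1]) * x p i j) - (b i : ℤ_[p.1])‖ ≤ (p.1 : ℝ) ^ (-(k p i : ℤ))) ∧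
      (∀ i, |(∑ j, (a j : ℝ) * θ i j) - (b i : ℝ)| < B i) ∧
      ∀ j, |(a j : ℝ)| ≤ A j := by
  choose X hX using fun i j => exists_int_forall_pow_dvd_sub T (fun p => k p i) fun p => x p i j
  let N : Fin n → ℕ := fun i => ∏ p ∈ T, p.1 ^ k p i
  have hN : ∀ i, N i ≠ 0 := fun i =>
    Finset.prod_ne_zero_iff.mpr fun p _ => pow_ne_zero _ p.2.ne_zero
  let M : Matrix (Fin m ⊕ Fin n) (Fin m ⊕ Fin n) ℝ :=
    Matrix.fromBlocks 1 0 (Matrix.of fun i j => (X i j : ℝ) - θ i j)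
      (Matrix.diagonal fun i => (N i : ℝ))
  have hdet : M.det = ∏ i, (N i : ℝ) := by
    simp [M, Matrix.det_fromBlocks_zero₁₂, Matrix.det_diagonal]
  have hdet_pos : 0 < M.det := by
    rw [hdet]
    exact Finset.prod_pos fun i _ => by exact_mod_cast Nat.pos_of_ne_zero (hN i)
  obtain ⟨z, hz0, hz₀, hz⟩ := M.exists_int_ne_zero_abs_mulVec_le hdet_pos.ne' (Sum.elim A B)
    (by rintro (j | i) <;> simp [hA, hB])
    (by
      rw [abs_of_pos hdet_pos, hdet, Fintype.prod_sum_type]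
      simpa [N] using h)
    (Sum.inl ⟨0, hm⟩)
  have hinl : ∀ j, M.mulVec (fun l => (z l : ℝ)) (Sum.inl j) = z (Sum.inl j) := fun j => by
    simp [M, Matrix.mulVec, dotProduct, Fintype.sum_sum_type, Matrix.one_apply]
  have hinr : ∀ i, M.mulVec (fun l => (z l : ℝ)) (Sum.inr i) =
      ∑ j, ((X i j : ℝ) - θ i j) * z (Sum.inl j) + N i * z (Sum.inr i) := fun i => by
    simp [M, Matrix.mulVec, dotProduct, Fintype.sum_sum_type, Matrix.diagonal_apply]
  refine ⟨fun j => z (Sum.inl j), fun i => ∑ j, X i j * z (Sum.inl j) + N i * z (Sum.inr i),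
    ?_, fun p hp i => ?_, fun i => ?_, fun j => ?_⟩
  · rintro ⟨ha, hb⟩
    refine hz0 (funext fun l => ?_)
    rcases l with j | i
    · exact congrFun ha j
    · have hi := congrFun hb i
      have ha' : ∀ j, z (Sum.inl j) = 0 := congrFun ha
      simpa [ha', hN i] using hi
  · let _ : Fact p.1.Prime := ⟨p.2⟩
    rw [PadicInt.norm_le_pow_iff_mem_span_pow, Ideal.mem_span_singleton]
    have hNdvd : ((p.1 : ℤ_[p.1]) ^ k p i) ∣ (N i : ℤ_[p.1]) := by
      have : p.1 ^ k p i ∣ N i := Finset.dvd_prod_of_mem (fun p : Nat.Primes => p.1 ^ k p i) hp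
      exact_mod_cast Nat.cast_dvd_cast (α := ℤ_[p.1]) this
    have hsum : ((p.1 : ℤ_[p.1]) ^ k p i) ∣
        ∑ j, (z (Sum.inl j) : ℤ_[p.1]) * (x p i j - (X i j : ℤ_[p.1])) :=
      Finset.dvd_sum fun j _ => (hX i j p hp).mul_left _
    convert! dvd_sub hsum (hNdvd.mul_right (z (Sum.inr i) : ℤ_[p.1])) using 1
    push_cast
    simp only [mul_sub, Finset.sum_sub_distrib]
    simp only [mul_comm]
    ring
  · have hi := hz (Sum.inr i) (by simp)
    rw [hinr, ← abs_neg] at hi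
    convert! hi using 2
    push_cast
    simp only [sub_mul, Finset.sum_sub_distrib, mul_comm]
    ring
  · rw [← hinl]
    rcases eq_or_ne j ⟨0, hm⟩ with rfl | hj
    · exact hz₀
    · exact (hz (Sum.inl j) (by simpa using hj)).le

/-- Removing the infinite place from a sum over a finite set of places. -/
theorem sum_eraseNone_eq_sub (S : Finset Pl) (f : Pl → ℝ) :
    ∑ p ∈ S.eraseNone, f (some p) = ∑ v ∈ S, f v - if none ∈ S then f none else 0 := by
  have hmap : ∑ p ∈ S.eraseNone, f (some p) = ∑ v ∈ S.erase none, f v := by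
    rw [← Finset.map_some_eraseNone, Finset.sum_map]
    rfl
  rw [hmap]
  split_ifs with h
  · rw [← Finset.add_sum_erase S f h]
    ring
  · rw [Finset.erase_eq_of_notMem h, sub_zero]

theorem linForm_zero_left {m n : ℕ} (v : Pl) (x : Fin n → Fin m → Pl.carrier v)
    (b : Fin n → ℤ) (i : Fin n) : linForm v x 0 b i = -(b i : Pl.carrier v) := by
  simp [linForm]

/-- Corollary (weighted S-arithmetic Dirichlet): for positive weights `τ` and `η` with
`∑ τ_{i,ν} = ω = ∑ η_ℓ` (`ω = m + n` if `∞ ∉ S`, `ω = m` if `∞ ∈ S`), every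
`x ∈ ℤ_S^{mn}` and `H > 1` admit a nonzero `(a,b) ∈ ℤ^{m+n}` solving the weighted
Dirichlet system; moreover, if `∞ ∈ S` or `η_{m+i} < ∑_ν τ_{i,ν}` for all `i`, then for
all sufficiently large `H` any nonzero solution of the system has `a ≠ 0`. -/
theorem weighted_s_arithmetic_dirichlet (S : Finset Pl) (hS : S.Nonempty) (m n : ℕ)
    (hm : 0 < m) (hn : 0 < n)
    (τ : Pl → Fin n → ℝ) (hτpos : ∀ v ∈ S, ∀ i : Fin n, 0 < τ v i)
    (ηa : Fin m → ℝ) (hηa : ∀ j, 0 < ηa j) (ηb : Fin n → ℝ) (hηb : ∀ i, 0 < ηb i)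
    (hτsum : ∑ v ∈ S, ∑ i : Fin n, τ v i =
      if none ∈ S then (m : ℝ) else (m : ℝ) + n)
    (hηsum : (∑ j, ηa j) + (if none ∈ S then 0 else ∑ i, ηb i) =
      if none ∈ S then (m : ℝ) else (m : ℝ) + n) :
    (∀ x : SpaceS S m n, (∀ (v : S) (i : Fin n) (j : Fin m), Pl.inZ v (x v i j)) →
      ∀ H : ℝ, 1 < H →
        ∃ (a : Fin m → ℤ) (b : Fin n → ℤ), ¬(a = 0 ∧ b = 0) ∧
          DiriSys S τ ηa ηb H x a b) ∧
    ((none ∈ S ∨ ∀ i : Fin n, ηb i < ∑ v ∈ S, τ v i) →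
      ∃ H₀ : ℝ, ∀ H : ℝ, H₀ ≤ H → 1 < H →
        ∀ x : SpaceS S m n, (∀ (v : S) (i : Fin n) (j : Fin m), Pl.inZ v (x v i j)) →
          ∀ (a : Fin m → ℤ) (b : Fin n → ℤ), ¬(a = 0 ∧ b = 0) →
            DiriSys S τ ηa ηb H x a b → a ≠ 0) := by
  constructor
  · intro x _ H hH
    have hH0 : 0 < H := one_pos.trans hH
    have hk : ∀ p : Nat.Primes, ∀ i, ∃ k : ℕ, some p ∈ S →
        (p.1 : ℝ) ^ k < H ^ τ (some p) i ∧ H ^ τ (some p) i ≤ (p.1 : ℝ) ^ (k + 1) := fun p i => by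
      by_cases hp : some p ∈ S
      · obtain ⟨k, hk⟩ := exists_pow_lt_rpow_le_pow_succ p.2.one_lt hH (hτpos _ hp i)
        exact ⟨k, fun _ => hk⟩
      · exact ⟨0, fun h => absurd h hp⟩
    choose k hk using hk
    let y : (p : Nat.Primes) → Fin n → Fin m → @PadicInt p.1 ⟨p.2⟩ := fun p =>
      if hp : some p ∈ S then x ⟨some p, hp⟩ else fun _ _ => 0
    let θ : Fin n → Fin m → ℝ := if h : none ∈ S then x ⟨none, h⟩ else fun _ _ => 0
    obtain ⟨a, b, hab, hfin, hinf, ha⟩ := exists_int_padic_real_approx hm S.eraseNone y θ k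
      (fun j => H ^ ηa j) (fun j => Real.rpow_pos_of_pos hH0 _)
      (fun i => H ^ (if none ∈ S then -τ none i else ηb i))
      (fun i => Real.rpow_pos_of_pos hH0 _) (by
        have hle : ∏ i, ∏ p ∈ S.eraseNone, (p.1 : ℝ) ^ k p i ≤
            ∏ i, ∏ p ∈ S.eraseNone, H ^ τ (some p) i :=
          Finset.prod_le_prod (fun i _ => Finset.prod_nonneg fun p _ => by positivity)
            fun i _ => Finset.prod_le_prod (fun p _ => by positivity)
              fun p hp => (hk p i (Finset.mem_eraseNone.mp hp)).1.le
        refine hle.trans_eq ?_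
        simp_rw [← Real.rpow_sum_of_pos hH0]
        rw [← Real.rpow_add hH0, Finset.sum_comm]
        congr 1
        rw [sum_eraseNone_eq_sub S fun v => ∑ i, τ v i, hτsum]
        split_ifs at hηsum ⊢
        · rw [Finset.sum_neg_distrib]
          linarith
        · linarith)
    refine ⟨a, b, hab, ?_, ?_, ha, fun hS' i => ?_⟩
    · rintro ⟨_ | p, hv⟩ i hne
      · exact absurd rfl hne
      · have hp0 : (0 : ℝ) < p.1 := by exact_mod_cast p.2.pos
        have hi := hfin p (Finset.mem_eraseNone.mpr hv) i
        have hy : y p = x ⟨some p, hv⟩ := dif_pos hv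
        rw [hy] at hi
        refine LE.le.trans hi ?_
        change _ ≤ (p.1 : ℝ) * H ^ (-τ (some p) i)
        rw [zpow_neg, zpow_natCast, Real.rpow_neg hH0.le, ← div_eq_mul_inv,
          inv_le_comm₀ (by positivity) (by positivity), inv_div, div_le_iff₀ hp0, ← pow_succ]
        exact (hk p i hv).2
    · rintro ⟨_ | p, hv⟩ i heq
      · have hi := hinf i
        have hθ : θ = x ⟨none, hv⟩ := dif_pos hv
        rw [hθ, if_pos hv] at hi
        exact hi
      · exact absurd heq (Option.some_ne_none p)
    · have hi := hinf i
      simpa [θ, hS'] using hi.le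
  · intro hcase
    by_cases hS' : none ∈ S
    · refine ⟨1, fun H _ hH x _ a b hab hsys ha => hab ⟨ha, funext fun i => ?_⟩⟩
      subst ha
      have hi := hsys.2.1 ⟨none, hS'⟩ i rfl
      rw [linForm_zero_left] at hi
      change |-(b i : ℝ)| < H ^ (-τ none i) at hi
      have hlt : H ^ (-τ none i) < 1 :=
        Real.rpow_lt_one_of_one_lt_of_neg hH (neg_lt_zero.mpr (hτpos _ hS' i))
      have hb : |(b i : ℝ)| < 1 := by simpa only [abs_neg] using hi.trans hlt
      exact Int.abs_lt_one_iff.mp (by exact_mod_cast hb)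
    · have hη := hcase.resolve_left hS'
      have hlarge : ∀ᶠ H : ℝ in Filter.atTop, ∀ i,
          (∏ p ∈ S.eraseNone, (p.1 : ℝ)) < H ^ ((∑ v ∈ S, τ v i) - ηb i) :=
        Filter.eventually_all.mpr fun i =>
          (tendsto_rpow_atTop (sub_pos.mpr (hη i))).eventually_gt_atTop _
      obtain ⟨H₀, hH₀⟩ := Filter.eventually_atTop.mp hlarge
      refine ⟨H₀, fun H hHH₀ hH x _ a b hab hsys ha => hab ⟨ha, funext fun i => ?_⟩⟩
      have hH0 : 0 < H := one_pos.trans hH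
      subst ha
      by_contra hb
      refine (hH₀ H hHH₀ i).not_ge ?_
      have hfin : ∀ p ∈ S.eraseNone, (letI : Fact p.1.Prime := ⟨p.2⟩; ‖(b i : ℤ_[p.1])‖) ≤
          (p.1 : ℝ) * H ^ (-τ (some p) i) := fun p hp => by
        let _ : Fact p.1.Prime := ⟨p.2⟩
        have hv := Finset.mem_eraseNone.mp hp
        have hi := hsys.1 ⟨some p, hv⟩ i (Option.some_ne_none p)
        rw [linForm_zero_left] at hi
        change ‖-(b i : ℤ_[p.1])‖ ≤ (p.1 : ℝ) * H ^ (-τ (some p) i) at hi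
        rwa [norm_neg] at hi
      have hone : 1 ≤ H ^ ηb i * ∏ p ∈ S.eraseNone, ((p.1 : ℝ) * H ^ (-τ (some p) i)) :=
        (one_le_abs_mul_prod_padicNorm S.eraseNone (b i) hb).trans
          (mul_le_mul (hsys.2.2.2 hS' i)
            (Finset.prod_le_prod (fun p _ => norm_nonneg _) hfin)
            (Finset.prod_nonneg fun p _ => norm_nonneg _) (by positivity))
      rw [Finset.prod_mul_distrib, ← Real.rpow_sum_of_pos hH0, Finset.sum_neg_distrib,
        sum_eraseNone_eq_sub S fun v => τ v i, if_neg hS', sub_zero, mul_left_comm,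
        ← Real.rpow_add hH0, ← sub_eq_add_neg, ← neg_sub, Real.rpow_neg hH0.le,
        ← div_eq_mul_inv, one_le_div (by positivity)] at hone
      exact hone

end
end
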